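/- For any ground GZ-formula φ and any total coherent interpretation ⟨σ,T⟩ (coherent w.r.t. aggregates): ⟨σ,T⟩ ⊨ φ if and only if T ⊨_cl φ. -/

import Mathlib

open Classical

noncomputable section

/-! ## Worlds (here and there) -/

inductive W : Type
  | h
  | t

/-- The ordering `h ≤ t` on worlds. -/
def W.le : W → W → Prop
  | .h, _ => True
  | .t, .t => True
  | .t, .h => False

/-! ## Tuples: nonempty finite tuples, encoded as head + tail -/

abbrev Tup (α : Type u) : Type u := α × List α

/-- The tuple `(g 0, …, g n)` determined by a family on `Fin (n+1)`. -/
def famToTup {α : Type u} {n : ℕ} (g : Fin (n + 1) → α) : Tup α :=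
  (g 0, List.ofFn fun i : Fin n => g i.succ)

/-- Combine a finite family of optional values into an optional family:
`some` iff all components are defined. -/
def optFam {α : Type u} {m : ℕ} (f : Fin m → Option α) : Option (Fin m → α) :=
  if h : ∀ i, (f i).isSome then some fun i => (f i).get (h i) else none

/-! ## The domain `D`: atoms (Herbrand terms) plus, at each finite level,
all sets of (nonempty) tuples over the previous level.
We realise it as the quotient of a type of "pre-domain elements" of finite
rank by extensional equivalence. -/

/-- Pre-domain elements over a type `A` of atoms: an atom, or a set of
nonempty tuples (each tuple encoded as head + tail), indexed by an arbitrary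
(small) index type. -/
inductive PD (A : Type) : Type 1
  | atom : A → PD A
  | set : (ι : Type) → (ι → PD A) → (ι → List (PD A)) → PD A

/-- `x` has rank at most `n` (atoms have rank `0`). -/
def PD.rankLe {A : Type} : ℕ → PD A → Prop
  | 0, .atom _ => True
  | 0, .set _ _ _ => False
  | _ + 1, .atom _ => True
  | n + 1, .set _ hd tl => ∀ i, PD.rankLe n (hd i) ∧ ∀ z ∈ tl i, PD.rankLe n z

/-- Finite rank: the element appears at some finite level `D^i` of the
domain hierarchy. -/
def PD.FiniteRank {A : Type} (x : PD A) : Prop := ∃ n, PD.rankLe n x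

/-- Extensional equivalence up to depth `n`. -/
def PD.EquivLe {A : Type} : ℕ → PD A → PD A → Prop
  | 0, .atom a, .atom b => a = b
  | 0, _, _ => False
  | _ + 1, .atom a, .atom b => a = b
  | n + 1, .set _ hd tl, .set _ hd' tl' =>
      (∀ i, ∃ j, PD.EquivLe n (hd i) (hd' j) ∧ List.Forall₂ (PD.EquivLe n) (tl i) (tl' j)) ∧
      (∀ j, ∃ i, PD.EquivLe n (hd i) (hd' j) ∧ List.Forall₂ (PD.EquivLe n) (tl i) (tl' j))
  | _ + 1, _, _ => False

/-- Extensional equivalence (witnessed at some finite depth). -/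
def PD.Equiv {A : Type} (x y : PD A) : Prop := ∃ n, PD.EquivLe n x y

/-- The domain over atoms `A`: finite-rank pre-domain elements modulo
extensional equivalence. -/
def DD (A : Type) : Type 1 :=
  Quot fun x y : { z : PD A // z.FiniteRank } => PD.Equiv x.1 y.1

def toD {A : Type} (x : PD A) (h : x.FiniteRank) : DD A := Quot.mk _ ⟨x, h⟩

def atomD {A : Type} (a : A) : DD A := toD (PD.atom a) ⟨0, by simp [PD.rankLe]⟩

/-- `z` (a pre-domain element) represents the domain element `w`. -/
def repD {A : Type} (z : PD A) (w : DD A) : Prop := ∃ h, w = toD z h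

/-- Membership of a tuple in a domain element (meaningful when the latter
is a set). -/
def dmem {A : Type} (v : Tup (DD A)) (d : DD A) : Prop :=
  ∃ (ι : Type) (hd : ι → PD A) (tl : ι → List (PD A)) (hfr : (PD.set ι hd tl).FiniteRank),
    d = toD (PD.set ι hd tl) hfr ∧ ∃ i, repD (hd i) v.1 ∧ List.Forall₂ repD (tl i) v.2

/-- The domain elements that are sets (the subset `𝒮 = D ∖ D⁰`). -/
def IsSetD {A : Type} (d : DD A) : Prop :=
  ∃ (ι : Type) (hd : ι → PD A) (tl : ι → List (PD A)) (hfr : (PD.set ι hd tl).FiniteRank),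
    d = toD (PD.set ι hd tl) hfr

/-- The domain element whose members are exactly the tuples in `s`
(`none` if there is no such element of the domain). -/
def mkSet? {A : Type} (s : Set (Tup (DD A))) : Option (DD A) :=
  if h : ∃ d : DD A, IsSetD d ∧ ∀ v, dmem v d ↔ v ∈ s then some h.choose else none


universe v

/-! ## Signatures -/

/-- A signature: Herbrand function (constructor) names `C`, evaluable
function names `F`, and predicate names `P`, each with an arity, with at
least one Herbrand constant. -/
structure Sig : Type (v + 1) where
  C : Type
  arC : C → ℕ
  F : Type v
  arF : F → ℕ
  P : Type
  arP : P → ℕ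
  hasConst : ∃ c, arC c = 0

/-- Ground Herbrand terms over constructors `C`. -/
inductive HTerm (C : Type) (ar : C → ℕ) : Type
  | mk : (c : C) → (Fin (ar c) → HTerm C ar) → HTerm C ar

/-- The domain `D` of a signature: the Herbrand universe `Terms_F(C)`
together with all (finite-level) sets of nonempty tuples over it. -/
abbrev D (S : Sig.{v}) : Type 1 := DD (HTerm S.C S.arC)

/-! ## Terms and formulas (with extensional and intensional sets).
Quantified variables and the variables bound by an intensional set are
handled by substitution of arbitrary domain elements (which are available
as constant terms via `GTerm.dom`), so terms and formulas below are the
*ground* terms and *sentences* of the language. -/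

mutual
  inductive GTerm (S : Sig.{v}) : Type (max 1 v)
    /-- every element of the domain is a (ground) term -/
    | dom : D S → GTerm S
    /-- Herbrand (constructor) function application -/
    | ctor : (c : S.C) → (Fin (S.arC c) → GTerm S) → GTerm S
    /-- evaluable function application -/
    | func : (f : S.F) → (Fin (S.arF f) → GTerm S) → GTerm S
    /-- extensional set `{τ⃗₁, …, τ⃗_m}` of `m` tuples of terms, each of
    arity `n+1` -/
    | eset : (m n : ℕ) → (Fin m → Fin (n + 1) → GTerm S) → GTerm S
    /-- intensional set `{x⃗ : τ⃗(x⃗) : φ(x⃗)}` with `k` bound variables and a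
    tuple of `n+1` terms -/
    | iset : (k n : ℕ) → ((Fin k → D S) → Fin (n + 1) → GTerm S) →
        ((Fin k → D S) → Formula S) → GTerm S

  inductive Formula (S : Sig.{v}) : Type (max 1 v)
    | falsum : Formula S
    | verum : Formula S
    | atom : (p : S.P) → (Fin (S.arP p) → GTerm S) → Formula S
    | eq : GTerm S → GTerm S → Formula S
    | and : Formula S → Formula S → Formula S
    | or : Formula S → Formula S → Formula S
    | imp : Formula S → Formula S → Formula S
    | all : (D S → Formula S) → Formula S
    | ex : (D S → Formula S) → Formula S
end

/-- `¬φ` is an abbreviation for `φ → ⊥`. -/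
def Formula.neg {S : Sig.{v}} (φ : Formula S) : Formula S := .imp φ .falsum

/-- Ground atoms over the domain: the Herbrand base. -/
def GAtom (S : Sig.{v}) : Type 1 := Σ p : S.P, Fin (S.arP p) → D S

/-! ## Assignments and interpretations -/

/-- An assignment maps every ground term to a domain element or `none`
(undefined, `u`). -/
abbrev Assign (S : Sig.{v}) := GTerm S → Option (D S)

/-- The conditions an assignment must satisfy: identity on domain
constants, strictness and substitutivity for function application, the
Herbrand interpretation of constructors on atoms, and evaluation of
extensional set terms. -/
def AssignValid {S : Sig.{v}} (σ : Assign S) : Prop :=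
  (∀ d, σ (.dom d) = some d) ∧
  (∀ c args, (∃ i, σ (args i) = none) → σ (.ctor c args) = none) ∧
  (∀ c args (ds : Fin (S.arC c) → D S), (∀ i, σ (args i) = some (ds i)) →
      σ (.ctor c args) = σ (.ctor c fun i => .dom (ds i))) ∧
  (∀ c (hs : Fin (S.arC c) → HTerm S.C S.arC),
      σ (.ctor c fun i => .dom (atomD (hs i))) = some (atomD (HTerm.mk c hs))) ∧
  (∀ f args, (∃ i, σ (args i) = none) → σ (.func f args) = none) ∧
  (∀ f args (ds : Fin (S.arF f) → D S), (∀ i, σ (args i) = some (ds i)) →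
      σ (.func f args) = σ (.func f fun i => .dom (ds i))) ∧
  (∀ m n tups, (∃ j i, σ (tups j i) = none) → σ (.eset m n tups) = none) ∧
  (∀ m n tups (ds : Fin m → Fin (n + 1) → D S), (∀ j i, σ (tups j i) = some (ds j i)) →
      σ (.eset m n tups) = mkSet? { v | ∃ j, v = famToTup (ds j) })

/-- `σ ≼ σ'` : on every ground term, `σ` agrees with `σ'` or is undefined. -/
def AssignLe {S : Sig.{v}} (σ σ' : Assign S) : Prop :=
  ∀ τ, σ τ = σ' τ ∨ σ τ = none

/-- An interpretation `⟨σʰ, σᵗ, Iʰ, Iᵗ⟩`. -/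
structure Interp (S : Sig.{v}) : Type (max 1 v) where
  sh : Assign S
  st : Assign S
  Ih : Set (GAtom S)
  It : Set (GAtom S)

/-- The assignment of `I` at world `w`. -/
def Interp.s {S : Sig.{v}} (I : Interp S) : W → Assign S
  | .h => I.sh
  | .t => I.st

/-- The atoms of `I` at world `w`. -/
def Interp.atoms {S : Sig.{v}} (I : Interp S) : W → Set (GAtom S)
  | .h => I.Ih
  | .t => I.It

/-- The defining conditions of an interpretation: both assignments are
proper assignments, `σʰ ≼ σᵗ` and `Iʰ ⊆ Iᵗ`. -/
def Interp.Valid {S : Sig.{v}} (I : Interp S) : Prop :=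
  AssignValid I.sh ∧ AssignValid I.st ∧ AssignLe I.sh I.st ∧ I.Ih ⊆ I.It

/-! ## 𝒮-satisfaction -/

/-- `SatS I w φ` : `I, w ⊨_𝒮 φ`. -/
def SatS {S : Sig.{v}} (I : Interp S) : W → Formula S → Prop
  | _, .falsum => False
  | _, .verum => True
  | w, .atom p args => ∃ ds : Fin (S.arP p) → D S,
      (∀ i, I.s w (args i) = some (ds i)) ∧ (⟨p, ds⟩ : GAtom S) ∈ I.atoms w
  | w, .eq t1 t2 => ∃ d, I.s w t1 = some d ∧ I.s w t2 = some d
  | w, .and a b => SatS I w a ∧ SatS I w b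
  | w, .or a b => SatS I w a ∨ SatS I w b
  | w, .imp a b => ∀ w', W.le w w' → (SatS I w' a → SatS I w' b)
  | w, .all b => ∀ d, SatS I w (b d)
  | w, .ex b => ∃ d, SatS I w (b d)

/-! ## Extension of intensional sets and the coherent closure -/

/-- The extension `ext(I, w, {x⃗ : τ⃗(x⃗) : φ(x⃗)})`: the set of values of the
tuples `τ⃗(c⃗)` for those `c⃗ ∈ D^k` with `I, w ⊨_𝒮 φ(c⃗)`; it is undefined if
one of these values is undefined (or if the resulting collection is not a
member of the domain). -/
def extw {S : Sig.{v}} (I : Interp S) (w : W) (k n : ℕ)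
    (tv : (Fin k → D S) → Fin (n + 1) → GTerm S)
    (φ : (Fin k → D S) → Formula S) : Option (D S) :=
  if ∃ c : Fin k → D S, SatS I w (φ c) ∧ ∃ i, I.s w (tv c i) = none then none
  else
    mkSet? { val | ∃ (c : Fin k → D S) (ds : Fin (n + 1) → D S),
      SatS I w (φ c) ∧ (∀ i, I.s w (tv c i) = some (ds i)) ∧ val = famToTup ds }

/-- The assignment `σ_I^w` of the coherent closure of `I`: it agrees with
`σ^w` on terms without intensional sets, it assigns to an intensional set
its extension at `t`, at `h` its extension when the two extensions agree
(and `u` otherwise), and is extended to all remaining terms by the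
assignment conditions. -/
def cval {S : Sig.{v}} (I : Interp S) (w : W) : GTerm S → Option (D S)
  | .dom d => some d
  | .ctor c args =>
      match optFam fun i => cval I w (args i) with
      | none => none
      | some ds => I.s w (.ctor c fun i => .dom (ds i))
  | .func f args =>
      match optFam fun i => cval I w (args i) with
      | none => none
      | some ds => I.s w (.func f fun i => .dom (ds i))
  | .eset _ _ tups =>
      match optFam fun j => optFam fun i => cval I w (tups j i) with
      | none => none
      | some g => mkSet? { val | ∃ j, val = famToTup (g j) }
  | .iset k n tv φ =>
      match w with
      | .t => extw I .t k n tv φ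
      | .h => if extw I .h k n tv φ = extw I .t k n tv φ then extw I .h k n tv φ else none

/-- The coherent closure `C(I)` of an interpretation. -/
def CohC {S : Sig.{v}} (I : Interp S) : Interp S :=
  ⟨cval I .h, cval I .t, I.Ih, I.It⟩

/-- `I` is coherent (w.r.t. intensional sets) iff `I = C(I)`. -/
def Interp.Coherent {S : Sig.{v}} (I : Interp S) : Prop := CohC I = I

/-! ## 0-formulas (no intensional sets) and `SQHT⁼_F` over `⟨C ∪ 𝒮, F, P⟩`.
A `0`-formula over `Σ = ⟨C, F, P⟩` is at the same time an `SQHT⁼_F` formula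
over the signature `⟨C ∪ 𝒮, F, P⟩`, whose Herbrand universe is the domain
`D`.  An `SQHT⁼_F` interpretation over `⟨C ∪ 𝒮, F, P⟩` is an interpretation
whose assignments are only defined on terms without intensional sets. -/

mutual
  def IsZeroT {S : Sig.{v}} : GTerm S → Prop
    | .dom _ => True
    | .ctor _ args => ∀ i, IsZeroT (args i)
    | .func _ args => ∀ i, IsZeroT (args i)
    | .eset _ _ tups => ∀ j i, IsZeroT (tups j i)
    | .iset _ _ _ _ => False

  def IsZeroF {S : Sig.{v}} : Formula S → Prop
    | .falsum => True
    | .verum => True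
    | .atom _ args => ∀ i, IsZeroT (args i)
    | .eq t1 t2 => IsZeroT t1 ∧ IsZeroT t2
    | .and a b => IsZeroF a ∧ IsZeroF b
    | .or a b => IsZeroF a ∧ IsZeroF b
    | .imp a b => IsZeroF a ∧ IsZeroF b
    | .all b => ∀ d, IsZeroF (b d)
    | .ex b => ∀ d, IsZeroF (b d)
end

/-- An `SQHT⁼_F` interpretation over `⟨C ∪ 𝒮, F, P⟩`: assignments are given
on the terms without intensional sets only. -/
structure FInterp (S : Sig.{v}) : Type (max 1 v) where
  sh : { τ : GTerm S // IsZeroT τ } → Option (D S)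
  st : { τ : GTerm S // IsZeroT τ } → Option (D S)
  Ih : Set (GAtom S)
  It : Set (GAtom S)

/-- The restriction `Î` of an `SQHT⁼_𝒮` interpretation to the terms without
intensional sets. -/
def Interp.hat {S : Sig.{v}} (I : Interp S) : FInterp S :=
  ⟨fun τ => I.sh τ.1, fun τ => I.st τ.1, I.Ih, I.It⟩

/-- The canonical extension of an `SQHT⁼_F` interpretation to all terms
(undefined outside terms without intensional sets); it is used to evaluate
`SQHT⁼_F` satisfaction, which only depends on the values on terms without
intensional sets. -/
def FInterp.toInterp {S : Sig.{v}} (J : FInterp S) : Interp S :=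
  ⟨fun τ => if h : IsZeroT τ then J.sh ⟨τ, h⟩ else none,
   fun τ => if h : IsZeroT τ then J.st ⟨τ, h⟩ else none, J.Ih, J.It⟩

/-- `SQHT⁼_F` satisfaction `I, w ⊨_F φ` (for `0`-formulas `φ`, i.e.
`SQHT⁼_F` formulas over `⟨C ∪ 𝒮, F, P⟩`): the same clauses as `⊨_𝒮`, with
quantifiers ranging over the Herbrand universe of `⟨C ∪ 𝒮, F, P⟩`. -/
def SatF {S : Sig.{v}} (J : FInterp S) (w : W) (φ : Formula S) : Prop :=
  SatS J.toInterp w φ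

/-- Validity of an `SQHT⁼_F` interpretation. -/
def FInterp.Valid {S : Sig.{v}} (J : FInterp S) : Prop := J.toInterp.Valid

/-! ## Orderings between interpretations, equilibrium and stable models -/

/-- `I₁ ≼ I₂` : same `there` component, smaller `here` component. -/
def ILe {S : Sig.{v}} (I1 I2 : Interp S) : Prop :=
  I1.It = I2.It ∧ I1.st = I2.st ∧ I1.Ih ⊆ I2.Ih ∧ AssignLe I1.sh I2.sh

/-- `I₁ ≺ I₂`. -/
def ILt {S : Sig.{v}} (I1 I2 : Interp S) : Prop := ILe I1 I2 ∧ I1 ≠ I2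

/-- The total interpretation `⟨σ, T⟩`. -/
def totalI {S : Sig.{v}} (σ : Assign S) (T : Set (GAtom S)) : Interp S := ⟨σ, σ, T, T⟩

/-- `I` is a model of the theory `Γ` : `I` is a (coherent) interpretation
and `I, h ⊨_𝒮 φ` for every `φ ∈ Γ`. -/
def ModelS {S : Sig.{v}} (I : Interp S) (Γ : Set (Formula S)) : Prop :=
  I.Valid ∧ I.Coherent ∧ ∀ φ ∈ Γ, SatS I .h φ

/-- `⟨σ, T⟩` is an equilibrium model of `Γ`. -/
def EqModelS {S : Sig.{v}} (Γ : Set (Formula S)) (σ : Assign S) (T : Set (GAtom S)) : Prop :=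
  ModelS (totalI σ T) Γ ∧ ∀ I', ILt I' (totalI σ T) → ¬ ModelS I' Γ

/-- `T` is a stable model of `Γ` (`SQHT⁼_𝒮` equilibrium semantics). -/
def StableS {S : Sig.{v}} (Γ : Set (Formula S)) (T : Set (GAtom S)) : Prop :=
  ∃ σ, EqModelS Γ σ T

/-- The ordering on `SQHT⁼_F` assignments. -/
def FAssignLe {S : Sig.{v}} (σ σ' : { τ : GTerm S // IsZeroT τ } → Option (D S)) : Prop :=
  ∀ τ, σ τ = σ' τ ∨ σ τ = none

/-- `≼` on `SQHT⁼_F` interpretations. -/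
def FILe {S : Sig.{v}} (J1 J2 : FInterp S) : Prop :=
  J1.It = J2.It ∧ J1.st = J2.st ∧ J1.Ih ⊆ J2.Ih ∧ FAssignLe J1.sh J2.sh

def FILt {S : Sig.{v}} (J1 J2 : FInterp S) : Prop := FILe J1 J2 ∧ J1 ≠ J2

def totalF {S : Sig.{v}} (σ : { τ : GTerm S // IsZeroT τ } → Option (D S))
    (T : Set (GAtom S)) : FInterp S := ⟨σ, σ, T, T⟩

/-- `J` is an `SQHT⁼_F` model of `Γ`. -/
def ModelF {S : Sig.{v}} (J : FInterp S) (Γ : Set (Formula S)) : Prop :=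
  J.Valid ∧ ∀ φ ∈ Γ, SatF J .h φ

/-- `T` is a stable model of `Γ` under the `SQHT⁼_F` equilibrium semantics
over the signature `⟨C ∪ 𝒮, F, P⟩`. -/
def StableF {S : Sig.{v}} (Γ : Set (Formula S)) (T : Set (GAtom S)) : Prop :=
  ∃ σ, ModelF (totalF σ T) Γ ∧ ∀ J', FILt J' (totalF σ T) → ¬ ModelF J' Γ
/-! ## Aggregates and the language `𝒜log` of Gelfond–Zhang. -/

/-- Arithmetic comparison relations. -/
inductive CmpOp : Type
  | eq
  | le
  | ge
  | lt
  | gt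
  | ne

def CmpOp.eval : CmpOp → ℤ → ℤ → Prop
  | .eq => fun a b => a = b
  | .le => fun a b => a ≤ b
  | .ge => fun a b => a ≥ b
  | .lt => fun a b => a < b
  | .gt => fun a b => a > b
  | .ne => fun a b => a ≠ b

/-- Extra structure on a signature for aggregates and arithmetic:
a set `𝒜` of unary aggregate names among the evaluable functions, each with
its associated function `f̂` (whose value is only relevant on the sets `𝒮`),
integer constants among the Herbrand constants, and arithmetic comparison
predicates. -/
structure GZExt (S : Sig.{0}) : Type 1 where
  isAgg : S.F → Prop
  agg_ar : ∀ f, isAgg f → S.arF f = 1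
  hat : S.F → D S → Option (D S)
  intC : ℤ → S.C
  int_ar : ∀ z, S.arC (intC z) = 0
  int_inj : Function.Injective intC
  cmpP : CmpOp → S.P
  cmp_ar : ∀ o, S.arP (cmpP o) = 2
  cmp_inj : Function.Injective cmpP

/-- The integer `z` as an element of the domain (a Herbrand constant). -/
def intD {S : Sig.{0}} (G : GZExt S) (z : ℤ) : D S :=
  atomD (HTerm.mk (G.intC z) fun i => Fin.elim0 (Fin.cast (G.int_ar z) i))

/-- The arithmetic comparison predicates have their standard meanings in
the interpretation `I`. -/
def ArithStd {S : Sig.{0}} (G : GZExt S) (I : Interp S) : Prop :=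
  ∀ (o : CmpOp) (ds : Fin (S.arP (G.cmpP o)) → D S) (w : W),
    (⟨G.cmpP o, ds⟩ : GAtom S) ∈ I.atoms w ↔
      ∃ a b : ℤ, ds (Fin.cast (G.cmp_ar o).symm 0) = intD G a ∧
        ds (Fin.cast (G.cmp_ar o).symm 1) = intD G b ∧ o.eval a b

/-- `I` is coherent w.r.t. aggregates: coherent w.r.t. intensional sets
and, for every aggregate name `f` and ground term `τ`,
`σʷ(f(τ)) = f̂(σʷ(τ))` whenever `σʷ(τ) ∈ 𝒮`, and `σᵗ(f(τ)) = u` otherwise. -/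
def AggCoherent {S : Sig.{0}} (G : GZExt S) (I : Interp S) : Prop :=
  I.Coherent ∧
    ∀ f, G.isAgg f → ∀ τ : GTerm S,
      (∀ w d, I.s w τ = some d → IsSetD d → I.s w (.func f fun _ => τ) = G.hat f d) ∧
      (¬ (∃ d, I.st τ = some d ∧ IsSetD d) → I.st (.func f fun _ => τ) = none)

/-! ### GZ formulas -/

/-- Ground GZ formulas without set atoms: built from (ground) predicate
atoms by `∧`, `∨`, `→` (and `⊥`).  These are the `0`-formulas allowed as
the condition of a GZ set name. -/
inductive GZB (S : Sig.{0}) : Type 1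
  | falsum : GZB S
  | patom : (p : S.P) → (Fin (S.arP p) → D S) → GZB S
  | and : GZB S → GZB S → GZB S
  | or : GZB S → GZB S → GZB S
  | imp : GZB S → GZB S → GZB S

/-- Ground GZ formulas: predicate atoms and set atoms
`f{x⃗ : φ(x⃗)} ⊴ n` (with `f` an aggregate name, `k+1` bound variables,
`φ` a `0`-formula and `n` an integer), combined by `∧`, `∨`, `→`. -/
inductive GZG {S : Sig.{0}} (G : GZExt S) : Type 1
  | falsum : GZG G
  | patom : (p : S.P) → (Fin (S.arP p) → D S) → GZG G
  | satom : (f : S.F) → G.isAgg f → (k : ℕ) →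
      ((Fin (k + 1) → D S) → GZB S) → CmpOp → ℤ → GZG G
  | and : GZG G → GZG G → GZG G
  | or : GZG G → GZG G → GZG G
  | imp : GZG G → GZG G → GZG G

/-- Classical satisfaction `T ⊨_cl` for formulas without set atoms. -/
def SatB {S : Sig.{0}} (T : Set (GAtom S)) : GZB S → Prop
  | .falsum => False
  | .patom p ds => (⟨p, ds⟩ : GAtom S) ∈ T
  | .and a b => SatB T a ∧ SatB T b
  | .or a b => SatB T a ∨ SatB T b
  | .imp a b => SatB T a → SatB T b

/-- Classical satisfaction `T ⊨_cl` for ground GZ formulas.  For a set atom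
`f{x⃗ : φ(x⃗)} ⊴ n`: `f̂` applied to the set `{c⃗ ∈ D^{|x⃗|} : T ⊨_cl φ(c⃗)}`
has some integer value `k` and `k ⊴ n` holds. -/
def SatG {S : Sig.{0}} {G : GZExt S} (T : Set (GAtom S)) : GZG G → Prop
  | .falsum => False
  | .patom p ds => (⟨p, ds⟩ : GAtom S) ∈ T
  | .satom f _ k body o n =>
      ∃ (d : D S) (z : ℤ),
        mkSet? { val | ∃ c : Fin (k + 1) → D S, SatB T (body c) ∧ val = famToTup c } = some d ∧
        G.hat f d = some (intD G z) ∧ o.eval z n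
  | .and a b => SatG T a ∧ SatG T b
  | .or a b => SatG T a ∨ SatG T b
  | .imp a b => SatG T a → SatG T b

/-- A formula without set atoms as an `SQHT⁼_𝒮` formula. -/
def GZB.toF {S : Sig.{0}} : GZB S → Formula S
  | .falsum => .falsum
  | .patom p ds => .atom p fun i => .dom (ds i)
  | .and a b => .and a.toF b.toF
  | .or a b => .or a.toF b.toF
  | .imp a b => .imp a.toF b.toF

/-- The set name `{x⃗ : φ(x⃗)}` (that is, `{x⃗ : x⃗ : φ(x⃗)}`) as an
intensional-set term. -/
def setName {S : Sig.{0}} (k : ℕ) (body : (Fin (k + 1) → D S) → GZB S) : GTerm S :=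
  .iset (k + 1) k (fun c i => .dom (c i)) fun c => (body c).toF

/-- The comparison atom `τ₁ ⊴ τ₂` as an `SQHT⁼_𝒮` formula. -/
def cmpAtom {S : Sig.{0}} (G : GZExt S) (o : CmpOp) (t1 t2 : GTerm S) : Formula S :=
  .atom (G.cmpP o) fun i => (fun j : Fin 2 => if j = 0 then t1 else t2) (Fin.cast (G.cmp_ar o) i)

/-- A ground GZ formula as an `SQHT⁼_𝒮` formula: the set atom
`f{x⃗ : φ(x⃗)} ⊴ n` becomes the atom `⊴(f({x⃗ : φ(x⃗)}), n)`. -/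
def GZG.toF {S : Sig.{0}} {G : GZExt S} : GZG G → Formula S
  | .falsum => .falsum
  | .patom p ds => .atom p fun i => .dom (ds i)
  | .satom f _ k body o n =>
      cmpAtom G o (.func f fun _ => setName k body) (.dom (intD G n))
  | .and a b => .and a.toF b.toF
  | .or a b => .or a.toF b.toF
  | .imp a b => .imp a.toF b.toF

/-- A GZ formula: the universal closure `∀x⃗ φ(x⃗)` of a ground GZ formula
with `k` free variables. -/
structure GZSent {S : Sig.{0}} (G : GZExt S) : Type 1 where
  k : ℕ
  body : (Fin k → D S) → GZG G

/-- Iterated universal quantification over `k` variables. -/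
def allk {S : Sig.{0}} : (k : ℕ) → ((Fin k → D S) → Formula S) → Formula S
  | 0, f => f fun i => i.elim0
  | k + 1, f => .all fun d => allk k fun c => f (Fin.cons d c)

/-- A GZ formula as an `SQHT⁼_𝒮` formula (its universal closure). -/
def GZSent.toF {S : Sig.{0}} {G : GZExt S} (s : GZSent G) : Formula S :=
  allk s.k fun c => (s.body c).toF

/-- The grounding `Gr(Γ)` of a GZ theory: all ground instances of its
formulas. -/
def GrOf {S : Sig.{0}} {G : GZExt S} (Γ : Set (GZSent G)) : Set (GZG G) :=
  { g | ∃ s ∈ Γ, ∃ c, g = s.body c }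

/-! ### Stable models on the `SQHT⁼_𝒮` side (with aggregates) -/

/-- `I` is a model (w.r.t. aggregates) of the theory `Γ`: `I` is an
interpretation, coherent w.r.t. aggregates, interpreting arithmetic
standardly, with `I, h ⊨_𝒮 φ` for every `φ ∈ Γ`. -/
def ModelAgg {S : Sig.{0}} (G : GZExt S) (I : Interp S) (Γ : Set (Formula S)) : Prop :=
  I.Valid ∧ AggCoherent G I ∧ ArithStd G I ∧ ∀ φ ∈ Γ, SatS I .h φ

/-- `T` is a stable model of `Γ` under the `SQHT⁼_𝒮` equilibrium semantics
with interpretations coherent w.r.t. aggregates. -/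
def StableAgg {S : Sig.{0}} (G : GZExt S) (Γ : Set (Formula S)) (T : Set (GAtom S)) : Prop :=
  ∃ σ, ModelAgg G (totalI σ T) Γ ∧ ∀ I', ILt I' (totalI σ T) → ¬ ModelAgg G I' Γ

/-! ### The GZ reduct -/

/-- The target language of the GZ reduct: ground formulas with (possibly
infinitary) conjunctions. -/
inductive RForm (S : Sig.{0}) : Type 2
  | falsum : RForm S
  | patom : (p : S.P) → (Fin (S.arP p) → D S) → RForm S
  | and : RForm S → RForm S → RForm S
  | or : RForm S → RForm S → RForm S
  | imp : RForm S → RForm S → RForm S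
  | conj : (ι : Type 1) → (ι → RForm S) → RForm S

/-- Classical satisfaction for reduct formulas. -/
def SatR {S : Sig.{0}} (T : Set (GAtom S)) : RForm S → Prop
  | .falsum => False
  | .patom p ds => (⟨p, ds⟩ : GAtom S) ∈ T
  | .and a b => SatR T a ∧ SatR T b
  | .or a b => SatR T a ∨ SatR T b
  | .imp a b => SatR T a → SatR T b
  | .conj _ f => ∀ i, SatR T (f i)

/-- The reduct `φ^T` of a formula without set atoms. -/
def GZB.reduct {S : Sig.{0}} (T : Set (GAtom S)) : GZB S → RForm S
  | .falsum => .falsum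
  | .patom p ds => if (⟨p, ds⟩ : GAtom S) ∈ T then .patom p ds else .falsum
  | .and a b => if SatB T (.and a b) then .and (a.reduct T) (b.reduct T) else .falsum
  | .or a b => if SatB T (.or a b) then .or (a.reduct T) (b.reduct T) else .falsum
  | .imp a b => if SatB T (.imp a b) then .imp (a.reduct T) (b.reduct T) else .falsum

/-- The GZ reduct `φ^T` of a ground GZ formula w.r.t. `T`: `⊥` if
`T ⊭_cl φ`; a satisfied set atom `f{x⃗ : ψ(x⃗)} ⊴ n` becomes
`(⋀ Gr⁺_T(ψ(x⃗)))^T`, the conjunction of the reducts of all ground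
instances of `ψ` classically satisfied by `T`. -/
def GZG.reduct {S : Sig.{0}} {G : GZExt S} (T : Set (GAtom S)) : GZG G → RForm S
  | .falsum => .falsum
  | .patom p ds => if (⟨p, ds⟩ : GAtom S) ∈ T then .patom p ds else .falsum
  | .satom f hf k body o n =>
      if SatG T (.satom f hf k body o n) then
        .conj { c : Fin (k + 1) → D S // SatB T (body c) } fun c => (body c.1).reduct T
      else .falsum
  | .and a b => if SatG T (.and a b) then .and (a.reduct T) (b.reduct T) else .falsum
  | .or a b => if SatG T (.or a b) then .or (a.reduct T) (b.reduct T) else .falsum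
  | .imp a b => if SatG T (.imp a b) then .imp (a.reduct T) (b.reduct T) else .falsum

/-- `T` is the `⊆`-minimal (classical) model of a set of reduct formulas. -/
def MinModel {S : Sig.{0}} (T : Set (GAtom S)) (Φ : Set (RForm S)) : Prop :=
  (∀ ψ ∈ Φ, SatR T ψ) ∧ ∀ T' ⊆ T, (∀ ψ ∈ Φ, SatR T' ψ) → T' = T

/-- `T` is a GZ-stable model of the GZ theory `Γ`: `T` is the `⊆`-minimal
model of the reduct `Gr(Γ)^T`. -/
def GZStable {S : Sig.{0}} {G : GZExt S} (Γ : Set (GZSent G)) (T : Set (GAtom S)) : Prop :=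
  MinModel T { r | ∃ g ∈ GrOf Γ, r = GZG.reduct T g }
theorem PD.EquivLe.atom_iff {A : Type} (a : A) {n : ℕ} {x y : PD A} (h : PD.EquivLe n x y) :
    x = .atom a ↔ y = .atom a := by
  cases n <;> cases x <;> cases y <;> simp_all [PD.EquivLe]

theorem atomD_injective {A : Type} : Function.Injective (atomD : A → DD A) := by
  intro a b h
  let isAtomA : DD A → Prop := Quot.lift (fun x => x.1 = PD.atom a) fun x y ⟨_, hn⟩ =>
    propext (hn.atom_iff a)
  have hb : isAtomA (atomD b) := h ▸ (rfl : isAtomA (atomD a))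
  exact (PD.atom.inj (show PD.atom b = PD.atom a from hb)).symm

theorem intD_injective {S : Sig.{0}} (G : GZExt S) : Function.Injective (intD G) := by
  intro a b h
  have h' := atomD_injective h
  injection h' with h₁ _
  exact G.int_inj h₁

theorem isSetD_of_mkSet?_eq_some {A : Type} {s : Set (Tup (DD A))} {d : DD A}
    (h : mkSet? s = some d) : IsSetD d := by
  unfold mkSet? at h
  split_ifs at h with hs
  exact Option.some.inj h ▸ hs.choose_spec.1

section Total

variable {S : Sig.{0}} {σ : Assign S} {T : Set (GAtom S)}

theorem totalI_s (w : W) : (totalI σ T).s w = σ := by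
  cases w <;> rfl

theorem totalI_atoms (w : W) : (totalI σ T).atoms w = T := by
  cases w <;> rfl

theorem satS_totalI_patom (hdom : ∀ d, σ (.dom d) = some d) (w : W) (p : S.P)
    (ds : Fin (S.arP p) → D S) :
    SatS (totalI σ T) w (.atom p fun i => .dom (ds i)) ↔ (⟨p, ds⟩ : GAtom S) ∈ T := by
  simp [SatS, totalI_s, totalI_atoms, hdom, ← funext_iff]

theorem forall_worldLe_iff {P : W → Prop} {q : Prop} (h : ∀ w, P w ↔ q) (w : W) :
    (∀ w', W.le w w' → P w') ↔ q :=
  ⟨fun H => (h .t).1 (H .t (by cases w <;> trivial)), fun H w' _ => (h w').2 H⟩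

theorem satS_totalI_toF_iff_satB (hdom : ∀ d, σ (.dom d) = some d) (φ : GZB S) (w : W) :
    SatS (totalI σ T) w φ.toF ↔ SatB T φ := by
  induction φ generalizing w with
  | falsum => simp [GZB.toF, SatS, SatB]
  | patom p ds => exact satS_totalI_patom hdom w p ds
  | and a b iha ihb => simp [GZB.toF, SatS, SatB, iha, ihb]
  | or a b iha ihb => simp [GZB.toF, SatS, SatB, iha, ihb]
  | imp a b iha ihb =>
    simp only [GZB.toF, SatS, SatB]
    exact forall_worldLe_iff (fun w' => imp_congr (iha w') (ihb w')) w

theorem totalI_setName_eq (hdom : ∀ d, σ (.dom d) = some d) (hC : (totalI σ T).Coherent)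
    (k : ℕ) (body : (Fin (k + 1) → D S) → GZB S) :
    σ (setName k body) =
      mkSet? { val | ∃ c : Fin (k + 1) → D S, SatB T (body c) ∧ val = famToTup c } := by
  have h : cval (totalI σ T) .t = σ := congrArg Interp.st hC
  rw [← congrFun h (setName k body)]
  simp only [setName, cval, extw, totalI_s, hdom, satS_totalI_toF_iff_satB hdom]
  rw [if_neg (by simp)]
  congr 1
  ext v
  simp [← funext_iff]

theorem func_setName_eq_some_iff {G : GZExt S} (hdom : ∀ d, σ (.dom d) = some d)
    (hC : AggCoherent G (totalI σ T)) {f : S.F} (hf : G.isAgg f) (k : ℕ)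
    (body : (Fin (k + 1) → D S) → GZB S) (e : D S) :
    σ (.func f fun _ => setName k body) = some e ↔
      ∃ d, mkSet? { val | ∃ c : Fin (k + 1) → D S, SatB T (body c) ∧ val = famToTup c } = some d ∧
        G.hat f d = some e := by
  obtain ⟨hset, hundef⟩ := hC.2 f hf (setName k body)
  have hval := totalI_setName_eq hdom hC.1 k body
  rw [← hval]
  cases hd : σ (setName k body) with
  | none =>
    have : σ (.func f fun _ => setName k body) = none :=
      hundef fun ⟨d, h, _⟩ => by simp [show σ (setName k body) = some d from h] at hd
    simp [this]
  | some d =>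
    have : σ (.func f fun _ => setName k body) = G.hat f d :=
      hset .t d hd (isSetD_of_mkSet?_eq_some (hval ▸ hd))
    simp [this]

theorem satS_totalI_cmpAtom {G : GZExt S} (hA : ArithStd G (totalI σ T)) (w : W) (o : CmpOp)
    (t₁ t₂ : GTerm S) :
    SatS (totalI σ T) w (cmpAtom G o t₁ t₂) ↔
      ∃ a b : ℤ, σ t₁ = some (intD G a) ∧ σ t₂ = some (intD G b) ∧ o.eval a b := by
  simp only [cmpAtom, SatS, totalI_s]
  constructor
  · rintro ⟨ds, hds, hmem⟩
    obtain ⟨a, b, ha, hb, hab⟩ := (hA o ds w).1 hmem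
    have h₀ := hds (Fin.cast (G.cmp_ar o).symm 0)
    have h₁ := hds (Fin.cast (G.cmp_ar o).symm 1)
    rw [ha] at h₀
    rw [hb] at h₁
    exact ⟨a, b, by simpa using h₀, by simpa using h₁, hab⟩
  · rintro ⟨a, b, ha, hb, hab⟩
    refine ⟨fun i => if Fin.cast (G.cmp_ar o) i = 0 then intD G a else intD G b,
      fun i => ?_, (hA o _ w).2 ⟨a, b, by simp, by simp, hab⟩⟩
    dsimp only
    split_ifs
    exacts [ha, hb]

theorem satS_totalI_toF_iff_satG {G : GZExt S} (hdom : ∀ d, σ (.dom d) = some d)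
    (hC : AggCoherent G (totalI σ T)) (hA : ArithStd G (totalI σ T)) (φ : GZG G) (w : W) :
    SatS (totalI σ T) w φ.toF ↔ SatG T φ := by
  induction φ generalizing w with
  | falsum => simp [GZG.toF, SatS, SatG]
  | patom p ds => exact satS_totalI_patom hdom w p ds
  | satom f hf k body o n =>
    simp only [GZG.toF, SatG, satS_totalI_cmpAtom hA, func_setName_eq_some_iff hdom hC hf, hdom,
      Option.some.injEq]
    constructor
    · rintro ⟨a, b, ⟨d, hd, hfd⟩, hb, hab⟩
      exact ⟨d, a, hd, hfd, intD_injective G hb ▸ hab⟩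
    · rintro ⟨d, a, hd, hfd, hab⟩
      exact ⟨a, n, ⟨d, hd, hfd⟩, rfl, hab⟩
  | and a b iha ihb => simp [GZG.toF, SatS, SatG, iha, ihb]
  | or a b iha ihb => simp [GZG.toF, SatS, SatG, iha, ihb]
  | imp a b iha ihb =>
    simp only [GZG.toF, SatS, SatG]
    exact forall_worldLe_iff (fun w' => imp_congr (iha w') (ihb w')) w

end Total

/-- For any ground GZ formula `φ` and any total
interpretation `⟨σ, T⟩` coherent w.r.t. aggregates:
`⟨σ, T⟩ ⊨ φ` iff `T ⊨_cl φ`. -/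
theorem total_sat_iff_satCl {S : Sig.{0}} (G : GZExt S)
    (σ : Assign S) (T : Set (GAtom S))
    (hV : (totalI σ T).Valid) (hC : AggCoherent G (totalI σ T))
    (hA : ArithStd G (totalI σ T)) (φ : GZG G) :
    SatS (totalI σ T) .h φ.toF ↔ SatG T φ :=
  satS_totalI_toF_iff_satG hV.1.1 hC hA φ .h

end
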